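/- Let T be a subsystem of a Lie triple system S over a field F such that S is ideally absorbed into T, and let s ∈ S. Then (T:s) is an essential ideal of T and C_T((T:s)) = 0. -/

import Mathlib

/-- A Lie triple system structure on an `F`-vector space `S`:
a trilinear map `b` satisfying `[x,x,z] = 0`, the cyclic identity and the
Leibniz (derivation) identity. -/
structure LTSStruct (F : Type*) (S : Type*) [Field F] [AddCommGroup S] [Module F S] where
  b : S → S → S → S
  add₁ : ∀ x x' y z, b (x + x') y z = b x y z + b x' y z
  smul₁ : ∀ (c : F) (x y z : S), b (c • x) y z = c • b x y z
  add₂ : ∀ x y y' z, b x (y + y') z = b x y z + b x y' z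
  smul₂ : ∀ (c : F) (x y z : S), b x (c • y) z = c • b x y z
  add₃ : ∀ x y z z', b x y (z + z') = b x y z + b x y z'
  smul₃ : ∀ (c : F) (x y z : S), b x y (c • z) = c • b x y z
  alt : ∀ x z, b x x z = 0
  cyclic : ∀ x y z, b x y z + b y z x + b z x y = 0
  leibniz : ∀ u v x y z,
    b u v (b x y z) = b (b u v x) y z + b x (b u v y) z + b x y (b u v z)

namespace LTSStruct

variable {F : Type*} [Field F] {S : Type*} [AddCommGroup S] [Module F S]

/-- `I` is an ideal of the whole Lie triple system `S`: `[I,S,S] ⊆ I`. -/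
def IsIdeal (L : LTSStruct F S) (I : Submodule F S) : Prop :=
  ∀ x ∈ I, ∀ y z : S, L.b x y z ∈ I

/-- `T` is a subsystem of `S`: `[T,T,T] ⊆ T`. -/
def IsSubsystem (L : LTSStruct F S) (T : Submodule F S) : Prop :=
  ∀ x ∈ T, ∀ y ∈ T, ∀ z ∈ T, L.b x y z ∈ T

/-- `I` is an ideal of the subsystem `T`: `I ⊆ T` and `[I,T,T] ⊆ I`. -/
def IsIdealOf (L : LTSStruct F S) (I T : Submodule F S) : Prop :=
  I ≤ T ∧ ∀ x ∈ I, ∀ y ∈ T, ∀ z ∈ T, L.b x y z ∈ I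

/-- The centralizer of a subset `I` in the whole system `S`:
`C_S(I) = {x ∈ S : [x,I,S] = [S,I,x] = 0}`. -/
def centralizer (L : LTSStruct F S) (I : Set S) : Set S :=
  {x | (∀ i ∈ I, ∀ t : S, L.b x i t = 0) ∧ (∀ t : S, ∀ i ∈ I, L.b t i x = 0)}

/-- The centralizer of a subset `I` in a subsystem `T`:
`C_T(I) = {x ∈ T : [x,I,T] = [T,I,x] = 0}`. -/
def relCentralizer (L : LTSStruct F S) (T : Submodule F S) (I : Set S) : Set S :=
  {x | x ∈ T ∧ (∀ i ∈ I, ∀ t ∈ T, L.b x i t = 0) ∧ (∀ t ∈ T, ∀ i ∈ I, L.b t i x = 0)}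

/-- The center `C(S) = {x ∈ S : [x,S,S] = 0}`. -/
def center (L : LTSStruct F S) : Set S := {x | ∀ y z : S, L.b x y z = 0}

/-- The center of a subsystem `T`: `C(T) = {x ∈ T : [x,T,T] = 0}`. -/
def relCenter (L : LTSStruct F S) (T : Submodule F S) : Set S :=
  {x | x ∈ T ∧ ∀ y ∈ T, ∀ z ∈ T, L.b x y z = 0}

/-- `S` is semiprime: `[S,I,I] ≠ 0` for every nonzero ideal `I`. -/
def IsSemiprime (L : LTSStruct F S) : Prop :=
  ∀ I : Submodule F S, L.IsIdeal I → I ≠ ⊥ → ∃ t : S, ∃ i ∈ I, ∃ j ∈ I, L.b t i j ≠ 0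

/-- `S` is prime: `[S,I,J] ≠ 0` for all nonzero ideals `I`, `J`. -/
def IsPrime (L : LTSStruct F S) : Prop :=
  ∀ I J : Submodule F S, L.IsIdeal I → L.IsIdeal J → I ≠ ⊥ → J ≠ ⊥ →
    ∃ t : S, ∃ i ∈ I, ∃ j ∈ J, L.b t i j ≠ 0

/-- `S` is nondegenerate: `[S,x,x] ≠ 0` for every nonzero `x`. -/
def IsNondegenerate (L : LTSStruct F S) : Prop :=
  ∀ x : S, x ≠ 0 → ∃ t : S, L.b t x x ≠ 0

/-- A subsystem `T` is semiprime: `[T,I,I] ≠ 0` for every nonzero ideal `I` of `T`. -/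
def RelSemiprime (L : LTSStruct F S) (T : Submodule F S) : Prop :=
  ∀ I : Submodule F S, L.IsIdealOf I T → I ≠ ⊥ → ∃ t ∈ T, ∃ i ∈ I, ∃ j ∈ I, L.b t i j ≠ 0

/-- A subsystem `T` is prime: `[T,I,J] ≠ 0` for all nonzero ideals `I`, `J` of `T`. -/
def RelPrime (L : LTSStruct F S) (T : Submodule F S) : Prop :=
  ∀ I J : Submodule F S, L.IsIdealOf I T → L.IsIdealOf J T → I ≠ ⊥ → J ≠ ⊥ →
    ∃ t ∈ T, ∃ i ∈ I, ∃ j ∈ J, L.b t i j ≠ 0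

/-- A subsystem `T` is nondegenerate: `[T,x,x] ≠ 0` for every nonzero `x ∈ T`. -/
def RelNondegenerate (L : LTSStruct F S) (T : Submodule F S) : Prop :=
  ∀ x ∈ T, x ≠ 0 → ∃ t ∈ T, L.b t x x ≠ 0

/-- An ideal `I` of `S` is essential if it hits every nonzero ideal of `S`. -/
def IsEssentialIdeal (L : LTSStruct F S) (I : Submodule F S) : Prop :=
  L.IsIdeal I ∧ ∀ J : Submodule F S, L.IsIdeal J → J ≠ ⊥ → I ⊓ J ≠ ⊥

/-- An ideal `I` of the subsystem `T` is essential in `T` if it hits every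
nonzero ideal of `T`. -/
def IsEssentialIdealOf (L : LTSStruct F S) (I T : Submodule F S) : Prop :=
  L.IsIdealOf I T ∧ ∀ J : Submodule F S, L.IsIdealOf J T → J ≠ ⊥ → I ⊓ J ≠ ⊥

/-- The elements `s`, `R(x₁,y₁)⋯R(xₙ,yₙ)(s)` with all `xᵢ, yᵢ ∈ T`, where
`R(x,y)(z) = [z,x,y]`. -/
inductive InIter (L : LTSStruct F S) (T : Submodule F S) (s : S) : S → Prop
  | base : InIter L T s s
  | step (z x y : S) : InIter L T s z → x ∈ T → y ∈ T → InIter L T s (L.b z x y)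

/-- `_T(s)`: the linear span in `S` of `s` and all `R(x₁,y₁)⋯R(xₙ,yₙ)(s)`,
`xᵢ, yᵢ ∈ T`. -/
def innerIdeal (L : LTSStruct F S) (T : Submodule F S) (s : S) : Submodule F S :=
  Submodule.span F {z | InIter L T s z}

/-- `(T:s) = {x ∈ T : [x,T,_T(s)] + [x,_T(s),T] ⊆ T}`. -/
def quotSet (L : LTSStruct F S) (T : Submodule F S) (s : S) : Set S :=
  {x | x ∈ T ∧ ∀ t ∈ T, ∀ u ∈ L.innerIdeal T s, L.b x t u ∈ T ∧ L.b x u t ∈ T}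

/-- `S` is a system of quotients of `T`. -/
def IsSystemOfQuotients (L : LTSStruct F S) (T : Submodule F S) : Prop :=
  L.IsSubsystem T ∧ ∀ s s' : S, s ≠ 0 →
    ∃ x ∈ T, ∃ y ∈ T, L.b s x y ≠ 0 ∧ (x ∈ L.quotSet T s' ∨ y ∈ L.quotSet T s')

/-- `S` is a weak system of quotients of `T`. -/
def IsWeakSystemOfQuotients (L : LTSStruct F S) (T : Submodule F S) : Prop :=
  L.IsSubsystem T ∧ ∀ s : S, s ≠ 0 → ∃ x ∈ T, ∃ y ∈ T, L.b s x y ≠ 0 ∧ L.b s x y ∈ T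

/-- `S` is ideally absorbed into `T`: for every `0 ≠ s ∈ S` there is an ideal `I`
of `T` with `C_T(I) = 0` and `0 ≠ [s,I,T] + [s,T,I] ⊆ T`. -/
def IsIdeallyAbsorbed (L : LTSStruct F S) (T : Submodule F S) : Prop :=
  L.IsSubsystem T ∧ ∀ s : S, s ≠ 0 → ∃ I : Submodule F S, L.IsIdealOf I T ∧
    L.relCentralizer T (I : Set S) = {0} ∧
    (∃ i ∈ I, ∃ t ∈ T, L.b s i t ≠ 0 ∨ L.b s t i ≠ 0) ∧
    (∀ i ∈ I, ∀ t ∈ T, L.b s i t ∈ T ∧ L.b s t i ∈ T)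

end LTSStruct

namespace LTSStruct

variable {F : Type*} [Field F] {S : Type*} [AddCommGroup S] [Module F S]

theorem skew (L : LTSStruct F S) (x y z : S) : L.b x y z = -L.b y x z := by
  have h := L.alt (x + y) z
  rw [L.add₁, L.add₂, L.add₂, L.alt, L.alt, zero_add, add_zero] at h
  exact eq_neg_of_add_eq_zero_left h

theorem zero₁ (L : LTSStruct F S) (y z : S) : L.b 0 y z = 0 := by
  simpa using L.smul₁ 0 0 y z

theorem zero₃ (L : LTSStruct F S) (x y : S) : L.b x y 0 = 0 := by
  simpa using L.smul₃ 0 x y 0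

/-- Membership of two cyclic rotations of a bracket in a submodule implies that of the third. -/
theorem mem_of_rotations (L : LTSStruct F S) {P : Submodule F S} {x y z : S}
    (h₁ : L.b y z x ∈ P) (h₂ : L.b z x y ∈ P) : L.b x y z ∈ P := by
  have h : L.b x y z = -(L.b y z x + L.b z x y) :=
    eq_neg_of_add_eq_zero_left (by rw [← add_assoc, L.cyclic])
  rw [h]
  exact P.neg_mem (P.add_mem h₁ h₂)

theorem mem_swap (L : LTSStruct F S) {P : Submodule F S} {x y z : S}
    (h : L.b y x z ∈ P) : L.b x y z ∈ P := by
  rw [L.skew]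
  exact P.neg_mem h

theorem innerIdeal_bracket_mem (L : LTSStruct F S) {T : Submodule F S} {s u x y : S}
    (hu : u ∈ L.innerIdeal T s) (hx : x ∈ T) (hy : y ∈ T) : L.b u x y ∈ L.innerIdeal T s := by
  induction hu using Submodule.span_induction with
  | mem z hz => exact Submodule.subset_span (InIter.step z x y hz hx hy)
  | zero => rw [L.zero₁]; exact zero_mem _
  | add a b _ _ ha hb => rw [L.add₁]; exact add_mem ha hb
  | smul c a _ ha => rw [L.smul₁]; exact Submodule.smul_mem _ c ha

/-- The set `(T:s)` as a submodule. -/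
def quotSubmodule (L : LTSStruct F S) (T : Submodule F S) (s : S) : Submodule F S where
  carrier := L.quotSet T s
  zero_mem' := ⟨zero_mem T, fun t _ u _ => by simp [L.zero₁]⟩
  add_mem' {a b} ha hb := ⟨T.add_mem ha.1 hb.1, fun t ht u hu => by
    rw [L.add₁, L.add₁]
    exact ⟨T.add_mem (ha.2 t ht u hu).1 (hb.2 t ht u hu).1,
      T.add_mem (ha.2 t ht u hu).2 (hb.2 t ht u hu).2⟩⟩
  smul_mem' c a ha := ⟨T.smul_mem c ha.1, fun t ht u hu => by
    rw [L.smul₁, L.smul₁]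
    exact ⟨T.smul_mem c (ha.2 t ht u hu).1, T.smul_mem c (ha.2 t ht u hu).2⟩⟩

theorem isIdealOf_quotSubmodule (L : LTSStruct F S) {T : Submodule F S} (hT : L.IsSubsystem T)
    (s : S) : L.IsIdealOf (L.quotSubmodule T s) T := by
  refine ⟨fun x hx => hx.1, fun x hx => ?_⟩
  obtain ⟨hxT, hx⟩ := hx
  have hR {v p q : S} (hv : v ∈ L.innerIdeal T s) (hp : p ∈ T) (hq : q ∈ T) :
      L.b v p q ∈ L.innerIdeal T s := L.innerIdeal_bracket_mem hv hp hq
  have middle {p q u w : S} (hp : p ∈ T) (hq : q ∈ T) (hw : w ∈ T)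
      (hu : u ∈ L.innerIdeal T s) : L.b w u (L.b x p q) ∈ T := by
    rw [L.leibniz]
    refine T.add_mem (T.add_mem ?_ ?_) ?_
    · exact hT _ (L.mem_of_rotations (L.mem_swap (hx w hw u hu).2) (hx w hw u hu).1)
        _ hp _ hq
    · exact (hx q hq _ (L.mem_swap (hR hu hw hp))).2
    · exact (hx p hp _ (L.mem_swap (hR hu hw hq))).1
  have right {p q t u : S} (hp : p ∈ T) (hq : q ∈ T) (ht : t ∈ T)
      (hu : u ∈ L.innerIdeal T s) : L.b (L.b x p q) u t ∈ T := by
    refine L.mem_swap ?_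
    have h : L.b u (L.b x p q) t =
        L.b x p (L.b u q t) - L.b (L.b x p u) q t - L.b u q (L.b x p t) := by
      rw [L.leibniz x p u q t]
      abel
    rw [h]
    exact T.sub_mem (T.sub_mem (hx p hp _ (hR hu hq ht)).1
      (hT _ (hx p hp u hu).1 _ hq _ ht)) (L.mem_swap (middle hp ht hq hu))
  exact fun y hy z hz => ⟨hT _ hxT _ hy _ hz, fun t ht u hu =>
    ⟨L.mem_of_rotations (middle hy hz ht hu) (L.mem_swap (right hy hz ht hu)),
      right hy hz ht hu⟩⟩

/-- If brackets of `s` with an ideal `I` and `T` land in `T`, then `I ⊆ (T:s)`. -/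
theorem le_quotSubmodule (L : LTSStruct F S) {T I : Submodule F S} (hT : L.IsSubsystem T)
    (hI : L.IsIdealOf I T) {s : S}
    (hs : ∀ i ∈ I, ∀ t ∈ T, L.b s i t ∈ T ∧ L.b s t i ∈ T) : I ≤ L.quotSubmodule T s := by
  obtain ⟨hIT, hI⟩ := hI
  have key : ∀ u ∈ L.innerIdeal T s, ∀ i ∈ I, ∀ t ∈ T, L.b u i t ∈ T ∧ L.b u t i ∈ T := by
    intro u hu
    induction hu using Submodule.span_induction with
    | zero => exact fun i _ t _ => by simp [L.zero₁]
    | add a b _ _ ha hb =>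
      intro i hi t ht
      rw [L.add₁, L.add₁]
      exact ⟨T.add_mem (ha i hi t ht).1 (hb i hi t ht).1,
        T.add_mem (ha i hi t ht).2 (hb i hi t ht).2⟩
    | smul c a _ ha =>
      intro i hi t ht
      rw [L.smul₁, L.smul₁]
      exact ⟨T.smul_mem c (ha i hi t ht).1, T.smul_mem c (ha i hi t ht).2⟩
    | mem u hu =>
      induction hu with
      | base => exact hs
      | step u x y _ hx hy ih =>
        have hIu {i p : S} (hi : i ∈ I) (hp : p ∈ T) : L.b i p u ∈ T :=
          L.mem_of_rotations (L.mem_swap (ih i hi p hp).2) (ih i hi p hp).1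
        have outer {i p t : S} (hi : i ∈ I) (hp : p ∈ T) (ht : t ∈ T) :
            L.b i p (L.b u x t) ∈ T := by
          rw [L.leibniz]
          exact T.add_mem (T.add_mem (hT _ (hIu hi hp) _ hx _ ht)
            (ih _ (hI i hi p hp x hx) t ht).1) (ih _ (hI i hi p hp t ht) x hx).2
        have left {i p t : S} (hi : i ∈ I) (hp : p ∈ T) (ht : t ∈ T) :
            L.b (L.b u x p) i t ∈ T := by
          have h : L.b (L.b u x p) i t =
              L.b u x (L.b p i t) - L.b p (L.b u x i) t - L.b p i (L.b u x t) := by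
            rw [L.leibniz u x p i t]
            abel
          rw [h]
          exact T.sub_mem (T.sub_mem (ih _ (L.mem_swap (hI i hi p hp t ht)) x hx).2
            (hT _ hp _ (ih i hi x hx).2 _ ht)) (L.mem_swap (outer hi hp ht))
        intro i hi t ht
        refine ⟨left hi hy ht, ?_⟩
        have h : L.b (L.b u x y) t i =
            L.b u x (L.b y t i) - L.b y (L.b u x t) i - L.b y t (L.b u x i) := by
          rw [L.leibniz u x y t i]
          abel
        rw [h]
        exact T.sub_mem (T.sub_mem
          (ih _ (L.mem_of_rotations (L.mem_swap (hI i hi t ht y hy)) (hI i hi y hy t ht)) x hx).2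
          (L.mem_of_rotations (left hi ht hy) (outer hi hy ht)))
          (hT _ hy _ ht _ (ih i hi x hx).2)
  exact fun i hi => ⟨hIT hi, fun t ht u hu =>
    ⟨L.mem_of_rotations (L.mem_swap (key u hu i hi t ht).2) (key u hu i hi t ht).1,
      L.mem_swap (key u hu i hi t ht).1⟩⟩

theorem IsIdeallyAbsorbed.exists_isIdealOf {L : LTSStruct F S} {T : Submodule F S}
    (h : L.IsIdeallyAbsorbed T) (s : S) :
    ∃ I : Submodule F S, L.IsIdealOf I T ∧ L.relCentralizer T (I : Set S) = {0} ∧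
      ∀ i ∈ I, ∀ t ∈ T, L.b s i t ∈ T ∧ L.b s t i ∈ T := by
  rcases ne_or_eq s 0 with hs | rfl
  · obtain ⟨I, hI, hC, -, hsI⟩ := h.2 s hs
    exact ⟨I, hI, hC, hsI⟩
  · rcases subsingleton_or_nontrivial S with _ | _
    · refine ⟨T, ⟨le_rfl, h.1⟩, Set.eq_singleton_iff_unique_mem.2
        ⟨⟨zero_mem T, ?_, ?_⟩, fun _ _ => Subsingleton.elim _ _⟩, ?_⟩
      · exact fun _ _ _ _ => L.zero₁ _ _
      · exact fun _ _ _ _ => L.zero₃ _ _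
      · exact fun _ _ _ _ => by simp [L.zero₁]
    · obtain ⟨s, hs⟩ := exists_ne (0 : S)
      obtain ⟨I, hI, hC, -⟩ := h.2 s hs
      exact ⟨I, hI, hC, fun _ _ _ _ => by simp [L.zero₁]⟩

/-- An ideal of `T` with zero centralizer in `T` is essential. -/
theorem IsIdealOf.isEssentialIdealOf {L : LTSStruct F S} {T Q : Submodule F S}
    (hQ : L.IsIdealOf Q T) (hC : L.relCentralizer T (Q : Set S) = {0}) :
    L.IsEssentialIdealOf Q T := by
  refine ⟨hQ, fun J hJ hJ0 hQJ => hJ0 ((Submodule.eq_bot_iff J).2 fun j hj => ?_)⟩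
  have hbot {z : S} (hzQ : z ∈ Q) (hzJ : z ∈ J) : z = 0 := by
    rw [← Submodule.mem_bot F, ← hQJ]
    exact ⟨hzQ, hzJ⟩
  have hjT := hJ.1 hj
  suffices j ∈ L.relCentralizer T (Q : Set S) by rwa [hC] at this
  refine ⟨hjT, fun q hq t ht => ?_, fun t ht q hq => ?_⟩
  · exact hbot (L.mem_swap (hQ.2 q hq j hjT t ht)) (hJ.2 j hj q (hQ.1 hq) t ht)
  · exact hbot (L.mem_swap (hQ.2 q hq t ht j hjT))
      (L.mem_of_rotations (L.mem_swap (hJ.2 j hj q (hQ.1 hq) t ht))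
        (hJ.2 j hj t ht q (hQ.1 hq)))

end LTSStruct

/-- if `S` is ideally absorbed into `T` and `s ∈ S`, then
`(T:s)` is an essential ideal of `T` and `C_T((T:s)) = 0`. -/
theorem quotSet_essential_of_isIdeallyAbsorbed
    {F S : Type*} [Field F] [AddCommGroup S] [Module F S]
    (L : LTSStruct F S) (T : Submodule F S) (h : L.IsIdeallyAbsorbed T) (s : S) :
    (∃ Q : Submodule F S, (Q : Set S) = L.quotSet T s ∧ L.IsEssentialIdealOf Q T) ∧
    L.relCentralizer T (L.quotSet T s) = {0} := by
  obtain ⟨I, hI, hC, hs⟩ := h.exists_isIdealOf s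
  have hle := L.le_quotSubmodule h.1 hI hs
  have hCQ : L.relCentralizer T (L.quotSet T s) = {0} := by
    refine Set.eq_singleton_iff_unique_mem.2 ⟨⟨zero_mem T, ?_, ?_⟩, fun x hx => ?_⟩
    · exact fun _ _ _ _ => L.zero₁ _ _
    · exact fun _ _ _ _ => L.zero₃ _ _
    · have hx' : x ∈ L.relCentralizer T (I : Set S) :=
        ⟨hx.1, fun i hi => hx.2.1 i (hle hi), fun t ht i hi => hx.2.2 t ht i (hle hi)⟩
      rwa [hC] at hx'
  exact ⟨⟨L.quotSubmodule T s, rfl, (L.isIdealOf_quotSubmodule h.1 s).isEssentialIdealOf hCQ⟩, hCQ⟩
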